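/- Let H be a subgraph of a simple graph G on {1,…,n}. Suppose E_H is finite-dimensional, let d₀ be the largest d with E_H^{d₀} ≠ 0, and let w₀ be an element spanning E_H^{d₀}. If w ∈ E_G satisfies w₀·w = 0, then w ∈ E_H⁺·E_G, the span of all products h·g with h ∈ E_H⁺ and g ∈ E_G. -/

import Mathlib

open scoped TensorProduct

namespace FK

/-- Defining relations of the Fomin–Kirillov algebra `E n`, with generators indexed by
ordered pairs `(i, j)`; we also impose `x_{ii} = 0` and the antisymmetry `x_{ji} = -x_{ij}`,
so that the generators of the algebra are the `x_{ij}` for `i < j`. -/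
inductive Rel (n : ℕ) : FreeAlgebra ℚ (Fin n × Fin n) → FreeAlgebra ℚ (Fin n × Fin n) → Prop
  | diag (i : Fin n) : Rel n (FreeAlgebra.ι ℚ (i, i)) 0
  | antisymm (i j : Fin n) (hij : i ≠ j) :
      Rel n (FreeAlgebra.ι ℚ (j, i)) (-FreeAlgebra.ι ℚ (i, j))
  | square (i j : Fin n) (hij : i ≠ j) :
      Rel n (FreeAlgebra.ι ℚ (i, j) * FreeAlgebra.ι ℚ (i, j)) 0
  | comm (i j k l : Fin n) (h : List.Nodup [i, j, k, l]) :
      Rel n (FreeAlgebra.ι ℚ (i, j) * FreeAlgebra.ι ℚ (k, l))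
        (FreeAlgebra.ι ℚ (k, l) * FreeAlgebra.ι ℚ (i, j))
  | cyclic (i j k : Fin n) (h : List.Nodup [i, j, k]) :
      Rel n (FreeAlgebra.ι ℚ (i, j) * FreeAlgebra.ι ℚ (j, k)
        + FreeAlgebra.ι ℚ (j, k) * FreeAlgebra.ι ℚ (k, i)
        + FreeAlgebra.ι ℚ (k, i) * FreeAlgebra.ι ℚ (i, j)) 0

/-- The Fomin–Kirillov algebra `E n`. -/
abbrev E (n : ℕ) : Type := RingQuot (Rel n)

/-- The generator `x_{ij}` of `E n`. -/
noncomputable def x (n : ℕ) (i j : Fin n) : E n :=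
  RingQuot.mkAlgHom ℚ (Rel n) (FreeAlgebra.ι ℚ (i, j))

/-- The product of generators `x_{i₁j₁} ⋯ x_{i_d j_d}` given by a list of pairs. -/
noncomputable def word (n : ℕ) (l : List (Fin n × Fin n)) : E n :=
  (l.map fun p => x n p.1 p.2).prod

/-- The degree-`d` component of `E n`: the span of products of `d` generators. -/
def degSpan (n : ℕ) (d : ℕ) : Submodule ℚ (E n) :=
  Submodule.span ℚ {y | ∃ l : List (Fin n × Fin n),
    (∀ p ∈ l, p.1 ≠ p.2) ∧ l.length = d ∧ y = word n l}

/-- The Fomin–Kirillov algebra of a graph `G`: the subalgebra of `E n` generated by the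
`x_{ij}` with `{i,j}` an edge of `G`. -/
def EG (n : ℕ) (G : SimpleGraph (Fin n)) : Subalgebra ℚ (E n) :=
  Algebra.adjoin ℚ {y | ∃ i j : Fin n, G.Adj i j ∧ y = x n i j}

/-- The degree-`d` component `E_G^d = E_G ∩ E_n^d`. -/
def EGdeg (n : ℕ) (G : SimpleGraph (Fin n)) (d : ℕ) : Submodule ℚ (E n) :=
  (EG n G).toSubmodule ⊓ degSpan n d

/-- The positive-degree part `E_G⁺` of `E_G`. -/
def EGplus (n : ℕ) (G : SimpleGraph (Fin n)) : Submodule ℚ (E n) :=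
  ⨆ d : ℕ, ⨆ _ : 1 ≤ d, EGdeg n G d


lemma x_diag (n : ℕ) (i : Fin n) : x n i i = 0 := by
  have := RingQuot.mkAlgHom_rel ℚ (Rel.diag (n := n) i)
  simpa [x] using this

lemma x_anti (n : ℕ) (i j : Fin n) : x n j i = - x n i j := by
  by_cases hij : i = j
  · subst hij; simp [x_diag]
  · have := RingQuot.mkAlgHom_rel ℚ (Rel.antisymm (n := n) i j hij)
    simpa [x] using this

lemma x_sq (n : ℕ) (i j : Fin n) : x n i j * x n i j = 0 := by
  by_cases hij : i = j
  · subst hij; simp [x_diag]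
  · have := RingQuot.mkAlgHom_rel ℚ (Rel.square (n := n) i j hij)
    simpa [x] using this

lemma x_comm (n : ℕ) (i j k l : Fin n) (h : List.Nodup [i, j, k, l]) :
    x n i j * x n k l = x n k l * x n i j := by
  have := RingQuot.mkAlgHom_rel ℚ (Rel.comm (n := n) i j k l h)
  simpa [x] using this

lemma x_cyc (n : ℕ) (i j k : Fin n) (h : List.Nodup [i, j, k]) :
    x n i j * x n j k + x n j k * x n k i + x n k i * x n i j = 0 := by
  have := RingQuot.mkAlgHom_rel ℚ (Rel.cyclic (n := n) i j k h)
  simpa [x] using this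

/-- Universal property of `E n`. -/
lemma exists_lift (n : ℕ) {B : Type*} [Ring B] [Algebra ℚ B] (f : Fin n → Fin n → B)
    (hd : ∀ i, f i i = 0) (ha : ∀ i j, i ≠ j → f j i = - f i j)
    (hs : ∀ i j, i ≠ j → f i j * f i j = 0)
    (hc : ∀ i j k l, List.Nodup [i, j, k, l] → f i j * f k l = f k l * f i j)
    (hy : ∀ i j k, List.Nodup [i, j, k] → f i j * f j k + f j k * f k i + f k i * f i j = 0) :
    ∃ F : E n →ₐ[ℚ] B, ∀ i j, F (x n i j) = f i j := by
  refine ⟨RingQuot.liftAlgHom ℚ ⟨FreeAlgebra.lift ℚ (fun p => f p.1 p.2), ?_⟩, ?_⟩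
  · intro a b hab
    cases hab with
    | diag i => simpa using hd i
    | antisymm i j h => simpa using ha i j h
    | square i j h => simpa using hs i j h
    | comm i j k l h => simpa using hc i j k l h
    | cyclic i j k h => simpa using hy i j k h
  · intro i j
    simp [x]

lemma hom_ext {n : ℕ} {B : Type*} [Ring B] [Algebra ℚ B] {F F' : E n →ₐ[ℚ] B}
    (h : ∀ i j, F (x n i j) = F' (x n i j)) : F = F' := by
  apply RingQuot.ringQuot_ext'
  apply FreeAlgebra.hom_ext
  funext p
  exact h p.1 p.2

/-- Abstract presentation of an algebra isomorphic to the Fomin-Kirillov algebra. -/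
structure FKData (n : ℕ) (A : Type) [Ring A] [Algebra ℚ A] (y : Fin n → Fin n → A) : Prop where
  x_diag : ∀ i, y i i = 0
  x_anti : ∀ i j, y j i = - y i j
  x_sq : ∀ i j, y i j * y i j = 0
  x_comm : ∀ i j k l, List.Nodup [i, j, k, l] → y i j * y k l = y k l * y i j
  x_cyc : ∀ i j k, List.Nodup [i, j, k] → y i j * y j k + y j k * y k i + y k i * y i j = 0
  lift : ∀ {B : Type} [Ring B] [Algebra ℚ B] (f : Fin n → Fin n → B),
    (∀ i, f i i = 0) → (∀ i j, i ≠ j → f j i = - f i j) →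
    (∀ i j, i ≠ j → f i j * f i j = 0) →
    (∀ i j k l, List.Nodup [i, j, k, l] → f i j * f k l = f k l * f i j) →
    (∀ i j k, List.Nodup [i, j, k] → f i j * f j k + f j k * f k i + f k i * f i j = 0) →
    ∃ F : A →ₐ[ℚ] B, ∀ i j, F (y i j) = f i j
  ext : ∀ {B : Type} [Ring B] [Algebra ℚ B] {F F' : A →ₐ[ℚ] B},
    (∀ i j, F (y i j) = F' (y i j)) → F = F'

lemma fkData (n : ℕ) : FKData n (E n) (x n) where
  x_diag := x_diag n
  x_anti := x_anti n
  x_sq := x_sq n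
  x_comm := x_comm n
  x_cyc := x_cyc n
  lift := exists_lift n
  ext := hom_ext

section Core

variable {n : ℕ} {A : Type} [Ring A] [Algebra ℚ A] {y : Fin n → Fin n → A}

lemma exists_act (hx : FKData n A y) (σ : Equiv.Perm (Fin n)) :
    ∃ F : A →ₐ[ℚ] A, ∀ i j, F (y i j) = y (σ i) (σ j) := by
  apply hx.lift
  · intro i; exact hx.x_diag _
  · intro i j _; exact hx.x_anti _ _
  · intro i j _; exact hx.x_sq _ _
  · intro i j k l h
    apply hx.x_comm
    simpa using h
  · intro i j k h
    apply hx.x_cyc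
    simpa using h

/-- Action of a permutation on `A`. -/
noncomputable def act (hx : FKData n A y) (σ : Equiv.Perm (Fin n)) : A →ₐ[ℚ] A :=
  (exists_act hx σ).choose

lemma act_x (hx : FKData n A y) (σ : Equiv.Perm (Fin n)) (i j : Fin n) :
    act hx σ (y i j) = y (σ i) (σ j) := (exists_act hx σ).choose_spec i j

lemma act_act (hx : FKData n A y) (σ τ : Equiv.Perm (Fin n)) (u : A) :
    act hx σ (act hx τ u) = act hx (σ * τ) u := by
  have : (act hx σ).comp (act hx τ) = act hx (σ * τ) := by
    apply hx.ext; intro i j; simp [act_x]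
  exact DFunLike.congr_fun this u

/-- The operator by which `x_{ij}` acts on `E ⊗ E` through the braided coproduct. -/
noncomputable def T (hx : FKData n A y) (i j : Fin n) : Module.End ℚ (A ⊗[ℚ] A) :=
  TensorProduct.map (LinearMap.mulLeft ℚ (y i j)) LinearMap.id +
    TensorProduct.map (act hx (Equiv.swap i j)).toLinearMap (LinearMap.mulLeft ℚ (y i j))

lemma T_tmul (hx : FKData n A y) (i j : Fin n) (u v : A) :
    T hx i j (u ⊗ₜ v) = (y i j * u) ⊗ₜ v + (act hx (Equiv.swap i j) u) ⊗ₜ (y i j * v) := by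
  simp [T]

lemma exists_rho (hx : FKData n A y) :
    ∃ F : A →ₐ[ℚ] Module.End ℚ (A ⊗[ℚ] A), ∀ i j, F (y i j) = T hx i j := by
  apply hx.lift
  · intro i
    apply TensorProduct.ext'
    intro u v
    simp [T_tmul, hx.x_diag]
  · intro i j _
    apply TensorProduct.ext'
    intro u v
    simp only [T_tmul, LinearMap.neg_apply, hx.x_anti i j, Equiv.swap_comm j i, neg_mul,
      TensorProduct.neg_tmul, TensorProduct.tmul_neg, neg_add]
  · intro i j _
    apply TensorProduct.ext'
    intro u v
    simp only [Module.End.mul_apply, T_tmul, map_add, map_mul, act_x, act_act, ← mul_assoc, hx.x_sq,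
      Equiv.swap_apply_left, Equiv.swap_apply_right, hx.x_anti i j, LinearMap.zero_apply,
      zero_mul, TensorProduct.zero_tmul, TensorProduct.tmul_zero, neg_mul,
      TensorProduct.neg_tmul]
    abel
  · intro i j k l h
    apply TensorProduct.ext'
    intro u v
    have h' := h
    simp only [List.nodup_cons, List.mem_cons, List.not_mem_nil, or_false, not_or,
      not_false_eq_true, List.nodup_nil, and_true] at h'
    obtain ⟨⟨h1, h2, h3⟩, ⟨h4, h5⟩, h6⟩ := h'
    have e1 : Equiv.swap i j k = k := Equiv.swap_apply_of_ne_of_ne (Ne.symm h2) (Ne.symm h4)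
    have e2 : Equiv.swap i j l = l := Equiv.swap_apply_of_ne_of_ne (Ne.symm h3) (Ne.symm h5)
    have e3 : Equiv.swap k l i = i := Equiv.swap_apply_of_ne_of_ne h2 h3
    have e4 : Equiv.swap k l j = j := Equiv.swap_apply_of_ne_of_ne h4 h5
    have e5 : Equiv.swap i j * Equiv.swap k l = Equiv.swap k l * Equiv.swap i j := by
      rw [Equiv.mul_swap_eq_swap_mul, e1, e2]
    simp only [Module.End.mul_apply, T_tmul, map_add, map_mul, act_x, act_act, ← mul_assoc,
      e1, e2, e3, e4, e5, hx.x_comm i j k l h]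
    abel
  · intro i j k h
    apply TensorProduct.ext'
    intro u v
    have h' := h
    simp only [List.nodup_cons, List.mem_cons, List.not_mem_nil, or_false, not_or,
      not_false_eq_true, List.nodup_nil, and_true] at h'
    obtain ⟨⟨h1, h2⟩, h3⟩ := h'
    have e1 : Equiv.swap i j k = k := Equiv.swap_apply_of_ne_of_ne (Ne.symm h2) (Ne.symm h3)
    have e2 : Equiv.swap j k i = i := Equiv.swap_apply_of_ne_of_ne h1 h2
    have e3 : Equiv.swap k i j = j := Equiv.swap_apply_of_ne_of_ne h3 (Ne.symm h1)
    have p1 : Equiv.swap j k * Equiv.swap k i = Equiv.swap i j * Equiv.swap j k := by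
      rw [Equiv.mul_swap_eq_swap_mul, Equiv.swap_apply_right, e2, Equiv.swap_comm j i]
    have p2 : Equiv.swap k i * Equiv.swap i j = Equiv.swap i j * Equiv.swap j k := by
      rw [Equiv.mul_swap_eq_swap_mul, Equiv.swap_apply_right, e3, ← p1,
        Equiv.swap_comm k j]
    have c := hx.x_cyc i j k h
    have c3 : y k i * y i j = -(y i j * y j k) - y j k * y k i := by
      rw [← sub_eq_zero, ← c]; abel
    simp only [Module.End.mul_apply, LinearMap.add_apply, T_tmul, map_add, map_mul, act_x,
      act_act, ← mul_assoc,
      e1, e2, e3, p1, p2, Equiv.swap_apply_left, Equiv.swap_apply_right, c3,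
      hx.x_anti i j, hx.x_anti j k, hx.x_anti k i, sub_mul, neg_mul, TensorProduct.neg_tmul,
      TensorProduct.sub_tmul, TensorProduct.tmul_sub, TensorProduct.tmul_neg,
      LinearMap.zero_apply]
    abel

lemma exists_eps (hx : FKData n A y) : ∃ F : A →ₐ[ℚ] ℚ, ∀ i j, F (y i j) = 0 := by
  apply hx.lift (fun _ _ => (0 : ℚ)) <;> simp

open Polynomial in
lemma exists_gam (hx : FKData n A y) : ∃ F : A →ₐ[ℚ] A[X], ∀ i j, F (y i j) = monomial 1 (y i j) := by
  apply hx.lift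
  · intro i; simp [hx.x_diag]
  · intro i j _; simp [hx.x_anti i j]
  · intro i j _; simp [monomial_mul_monomial, hx.x_sq]
  · intro i j k l h; simp [monomial_mul_monomial, hx.x_comm i j k l h]
  · intro i j k h
    simp only [monomial_mul_monomial, ← map_add, hx.x_cyc i j k h, map_zero]

open Polynomial in
/-- A functional detecting the coefficient `ε(c)` in `w₀ c`, for homogeneous `w₀ ≠ 0`. -/
lemma exists_functional (hx : FKData n A y) (d : ℕ) (ε : A →ₐ[ℚ] ℚ) (hε : ∀ i j, ε (y i j) = 0)
    (w₀ : A) (hw : w₀ ∈ Submodule.span ℚ {z | ∃ l : List (Fin n × Fin n),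
      (∀ p ∈ l, p.1 ≠ p.2) ∧ l.length = d ∧ z = (l.map fun p => y p.1 p.2).prod}) (h0 : w₀ ≠ 0) :
    ∃ φ : A →ₗ[ℚ] ℚ, ∀ c, φ (w₀ * c) = ε c := by
  obtain ⟨γ, hγ⟩ := exists_gam hx
  have hw0 : γ w₀ = monomial d w₀ := by
    induction hw using Submodule.span_induction with
    | mem y hy =>
      obtain ⟨l, -, rfl, rfl⟩ := hy
      clear h0
      induction l with
      | nil => simp
      | cons p l ih =>
        rw [List.map_cons, List.prod_cons, map_mul, ih, hγ, monomial_mul_monomial, List.length_cons, add_comm]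
    | zero => simp
    | add a b _ _ ha hb =>
      by_cases ha0 : a = 0
      · subst ha0
        rw [zero_add] at h0 ⊢
        exact hb h0
      by_cases hb0 : b = 0
      · subst hb0
        rw [add_zero] at h0 ⊢
        exact ha h0
      rw [map_add, ha ha0, hb hb0, map_add]
    | smul r a _ ha =>
      by_cases ha0 : a = 0
      · subst ha0; simp at h0
      rw [map_smul, ha ha0, smul_monomial]
  have hc : ∀ c, (γ c).coeff 0 = algebraMap ℚ (A) (ε c) := by
    intro c
    let κ : A[X] →ₐ[ℚ] A :=
      { (Polynomial.constantCoeff : A[X] →+* A) with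
        commutes' := by 
          intro r
          change (algebraMap ℚ A[X] r).coeff 0 = _
          rw [Polynomial.algebraMap_apply, coeff_C_zero] }
    have : κ.comp γ = (Algebra.ofId ℚ (A)).comp ε := by
      apply hx.ext
      intro i j
      simp only [AlgHom.comp_apply, hε, map_zero, hγ]
      change (monomial 1 (y i j)).coeff 0 = 0
      simp [coeff_monomial]
    exact DFunLike.congr_fun this c
  obtain ⟨ψ, hψ⟩ := Module.Projective.exists_dual_ne_zero ℚ h0
  refine ⟨(ψ w₀)⁻¹ • (ψ ∘ₗ ((Polynomial.lcoeff (A) d).restrictScalars ℚ) ∘ₗ γ.toLinearMap), ?_⟩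
  intro c
  have : (γ (w₀ * c)).coeff d = ε c • w₀ := by
    have := coeff_monomial_mul (γ c) d 0 w₀
    rw [zero_add] at this
    rw [map_mul, hw0, this, hc, ← Algebra.commutes, ← Algebra.smul_def]
  simp only [LinearMap.smul_apply, LinearMap.comp_apply, AlgHom.toLinearMap_apply,
    LinearMap.restrictScalars_apply, lcoeff_apply, this, map_smul, smul_eq_mul]
  field_simp

/-- The span of `c ⊗ d` with `c ∈ P`, `d ∈ S`. -/
noncomputable abbrev TS (P S : Submodule ℚ (A)) : Submodule ℚ (A ⊗[ℚ] A) :=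
  Submodule.map₂ (TensorProduct.mk ℚ (A) (A)) P S

lemma tmul_mem_TS {P S : Submodule ℚ (A)} {c d : A} (hc : c ∈ P) (hd : d ∈ S) :
    c ⊗ₜ[ℚ] d ∈ TS P S := Submodule.apply_mem_map₂ (TensorProduct.mk ℚ (A) (A)) hc hd

lemma map_TS {M : Type*} [AddCommGroup M] [Module ℚ M]
    (f : A ⊗[ℚ] A →ₗ[ℚ] M) {P S : Submodule ℚ (A)} (R : Submodule ℚ M)
    (h : ∀ c ∈ P, ∀ d ∈ S, f (c ⊗ₜ d) ∈ R) {t : A ⊗[ℚ] A} (ht : t ∈ TS P S) : f t ∈ R := by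
  have : TS P S ≤ R.comap f := Submodule.map₂_le.2 h
  exact this ht

/-- Abstract version of `EG`. -/
def EGa (y : Fin n → Fin n → A) (G : SimpleGraph (Fin n)) : Subalgebra ℚ A :=
  Algebra.adjoin ℚ {z | ∃ i j : Fin n, G.Adj i j ∧ z = y i j}

theorem core (hx : FKData n A y) (G H : SimpleGraph (Fin n)) (hHG : H ≤ G) (d₀ : ℕ)
    (w₀ : A) (hwH : w₀ ∈ EGa y H)
    (hwd : w₀ ∈ Submodule.span ℚ {z | ∃ l : List (Fin n × Fin n),
      (∀ p ∈ l, p.1 ≠ p.2) ∧ l.length = d₀ ∧ z = (l.map fun p => y p.1 p.2).prod})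
    (hne : w₀ ≠ 0) (J : Submodule ℚ A)
    (hJ : ∀ i j, H.Adj i j → ∀ g ∈ EGa y G, y i j * g ∈ J)
    (w : A) (hw : w ∈ EGa y G) (hkill : w₀ * w = 0) : w ∈ J := by
  obtain ⟨ε, hε⟩ := exists_eps hx
  obtain ⟨φ, hφ⟩ := exists_functional hx d₀ ε hε w₀ hwd hne
  obtain ⟨ρ, hρ⟩ := exists_rho hx
  have hεact : ∀ σ u, ε (act hx σ u) = ε u := by
    intro σ u
    have : ε.comp (act hx σ) = ε := by
      apply hx.ext; intro i j; simp [act_x, hε]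
    exact DFunLike.congr_fun this u
  let P : Submodule ℚ (A) := LinearMap.ker ε.toLinearMap
  have hP : ∀ c, c ∈ P ↔ ε c = 0 := fun c => Iff.rfl
  let S : Submodule ℚ (A) := (EGa y G).toSubmodule
  have hxS : ∀ i j, G.Adj i j → y i j ∈ EGa y G := fun i j h =>
    Algebra.subset_adjoin ⟨i, j, h, rfl⟩
  -- first claim
  have claim1 : ∀ u ∈ EGa y G, (∀ t ∈ TS P S, ρ u t ∈ TS P S) ∧
      ∀ v ∈ EGa y G, ρ u (1 ⊗ₜ v) - 1 ⊗ₜ (u * v) ∈ TS P S := by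
    intro u hu
    induction hu using Algebra.adjoin_induction with
    | mem z hy =>
      obtain ⟨i, j, hij, rfl⟩ := hy
      rw [hρ]
      constructor
      · intro t ht
        refine map_TS (T hx i j) (TS P S) ?_ ht
        intro c hc d hd
        rw [T_tmul]
        refine add_mem (tmul_mem_TS ?_ hd) (tmul_mem_TS ?_ ?_)
        · rw [hP, map_mul, hε, zero_mul]
        · rw [hP, hεact]; exact hc
        · exact (EGa y G).mul_mem (hxS i j hij) hd
      · intro v hv
        rw [T_tmul, map_one, add_sub_cancel_right]
        exact tmul_mem_TS (by rw [hP, map_mul, hε, zero_mul]) hv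
    | algebraMap r =>
      constructor
      · intro t ht
        rw [AlgHom.commutes, Module.algebraMap_end_apply]
        exact Submodule.smul_mem _ _ ht
      · intro v hv
        rw [AlgHom.commutes, Module.algebraMap_end_apply, ← Algebra.smul_def,
          TensorProduct.tmul_smul, sub_self]
        exact zero_mem _
    | add a b _ _ ha hb =>
      constructor
      · intro t ht
        rw [map_add, LinearMap.add_apply]
        exact add_mem (ha.1 t ht) (hb.1 t ht)
      · intro v hv
        rw [map_add, LinearMap.add_apply, add_mul, TensorProduct.tmul_add, add_sub_add_comm]
        exact add_mem (ha.2 v hv) (hb.2 v hv)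
    | mul a b ha' hb' ha hb =>
      constructor
      · intro t ht
        rw [map_mul, Module.End.mul_apply]
        exact ha.1 _ (hb.1 t ht)
      · intro v hv
        have h1 := ha.1 _ (hb.2 v hv)
        have h2 := ha.2 (b * v) (mul_mem hb' hv)
        rw [map_sub] at h1
        have h3 := add_mem h1 h2
        rw [sub_add_sub_cancel, ← mul_assoc] at h3
        rw [map_mul, Module.End.mul_apply]
        exact h3
  -- second claim
  let L : A → Module.End ℚ (A ⊗[ℚ] A) := fun h =>
    TensorProduct.map (LinearMap.mulLeft ℚ h) LinearMap.id
  have hL : ∀ h c d, L h (c ⊗ₜ d) = (h * c) ⊗ₜ d := fun h c d => by simp [L]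
  have claim2 : ∀ h ∈ EGa y H, ∀ t ∈ TS ⊤ S, ρ h t ∈ TS ⊤ S ∧ ρ h t - L h t ∈ TS ⊤ J := by
    intro h hh
    induction hh using Algebra.adjoin_induction with
    | mem z hy =>
      obtain ⟨i, j, hij, rfl⟩ := hy
      rw [hρ]
      intro t ht
      constructor
      · refine map_TS (T hx i j) (TS ⊤ S) ?_ ht
        intro c hc d hd
        rw [T_tmul]
        exact add_mem (tmul_mem_TS trivial hd)
          (tmul_mem_TS trivial ((EGa y G).mul_mem (hxS i j (hHG hij)) hd))
      · refine map_TS (T hx i j - L (y i j)) (TS ⊤ J) ?_ ht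
        intro c hc d hd
        rw [LinearMap.sub_apply, hL, T_tmul, add_sub_cancel_left]
        exact tmul_mem_TS trivial
          (hJ i j hij d hd)
    | algebraMap r =>
      intro t ht
      have e : L (algebraMap ℚ (A) r) t = r • t := by
        have : L (algebraMap ℚ (A) r) = r • LinearMap.id := by
          apply TensorProduct.ext'
          intro c d
          rw [hL, ← Algebra.smul_def]; rfl
        rw [this]; rfl
      rw [AlgHom.commutes, Module.algebraMap_end_apply, e, sub_self]
      exact ⟨Submodule.smul_mem _ _ ht, zero_mem _⟩
    | add a b _ _ ha hb =>
      intro t ht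
      have e : L (a + b) = L a + L b := by
        apply TensorProduct.ext'
        intro c d
        rw [LinearMap.add_apply, hL, hL, hL, add_mul, TensorProduct.add_tmul]
      rw [map_add, e, LinearMap.add_apply, LinearMap.add_apply, add_sub_add_comm]
      exact ⟨add_mem (ha t ht).1 (hb t ht).1, add_mem (ha t ht).2 (hb t ht).2⟩
    | mul a b _ _ ha hb =>
      intro t ht
      have e : L (a * b) = L a * L b := by
        apply TensorProduct.ext'
        intro c d
        rw [Module.End.mul_apply, hL, hL, hL, mul_assoc]
      rw [map_mul, e, Module.End.mul_apply, Module.End.mul_apply]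
      obtain ⟨hb1, hb2⟩ := hb t ht
      obtain ⟨ha1, ha2⟩ := ha _ hb1
      refine ⟨ha1, ?_⟩
      have h1 : L a (ρ b t - L b t) ∈ TS ⊤ J := by
        refine map_TS (L a) (TS ⊤ J) ?_ hb2
        intro c _ d hd
        rw [hL]
        exact tmul_mem_TS trivial hd
      rw [map_sub] at h1
      have h2 := add_mem ha2 h1
      rwa [sub_add_sub_cancel] at h2
  -- conclusion
  set r := ρ w (1 ⊗ₜ 1) - 1 ⊗ₜ (w * 1) with hr
  have hrm : r ∈ TS P S := (claim1 w hw).2 1 (one_mem _)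
  have hρw : ρ w (1 ⊗ₜ 1) = 1 ⊗ₜ w + r := by rw [hr, mul_one]; abel
  have hmemt : ρ w (1 ⊗ₜ 1) ∈ TS ⊤ S := by
    rw [hρw]
    exact add_mem (tmul_mem_TS trivial hw) (Submodule.map₂_le_map₂_left le_top hrm)
  have hfin := (claim2 w₀ hwH _ hmemt).2
  have hz : ρ w₀ (ρ w (1 ⊗ₜ 1)) = 0 := by
    rw [← Module.End.mul_apply, ← map_mul, hkill, map_zero, LinearMap.zero_apply]
  rw [hz, zero_sub, neg_mem_iff, hρw, map_add, hL] at hfin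
  let Φ : A ⊗[ℚ] A →ₗ[ℚ] A :=
    (TensorProduct.lid ℚ (A)).toLinearMap ∘ₗ TensorProduct.map φ LinearMap.id
  have hΦ : ∀ c d, Φ (c ⊗ₜ d) = φ c • d := fun c d => by simp [Φ]
  have hΦJ : Φ ((w₀ * 1) ⊗ₜ w + L w₀ r) ∈ J := by
    refine map_TS Φ J ?_ hfin
    intro c _ d hd
    rw [hΦ]
    exact Submodule.smul_mem _ _ hd
  have hΦr : (Φ ∘ₗ L w₀) r ∈ (⊥ : Submodule ℚ (A)) := by
    refine map_TS (Φ ∘ₗ L w₀) ⊥ ?_ hrm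
    intro c hc d _
    rw [LinearMap.comp_apply, hL, hΦ, hφ, (hP c).1 hc, zero_smul]
    exact zero_mem _
  rw [Submodule.mem_bot, LinearMap.comp_apply] at hΦr
  rwa [map_add, hΦr, add_zero, hΦ, hφ, map_one, one_smul] at hΦJ

end Core

lemma x_mem_plus (n : ℕ) (H : SimpleGraph (Fin n)) (i j : Fin n) (h : H.Adj i j) :
    x n i j ∈ EGplus n H := by
  refine Submodule.mem_iSup_of_mem 1 (Submodule.mem_iSup_of_mem le_rfl ⟨?_, ?_⟩)
  · exact Algebra.subset_adjoin ⟨i, j, h, rfl⟩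
  · exact Submodule.subset_span ⟨[(i, j)], by simpa using h.ne, rfl, by simp [word]⟩

/-- let `H ⊆ G` with `E_H` finite-dimensional, top degree `d₀`, and `w₀`
spanning `E_H^{d₀}`.  If `w ∈ E_G` satisfies `w₀·w = 0`, then `w ∈ E_H⁺·E_G`. -/
theorem stmt17 (n : ℕ) (hn : 1 ≤ n) (G H : SimpleGraph (Fin n)) (hHG : H ≤ G)
    (hfd : FiniteDimensional ℚ ↥(EG n H)) (d₀ : ℕ)
    (h₀ : EGdeg n H d₀ ≠ ⊥) (hmax : ∀ d : ℕ, d₀ < d → EGdeg n H d = ⊥)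
    (w₀ : E n) (hw₀ : EGdeg n H d₀ = Submodule.span ℚ {w₀})
    (w : E n) (hw : w ∈ EG n G) (hkill : w₀ * w = 0) :
    w ∈ Submodule.span ℚ {y : E n | ∃ h ∈ EGplus n H, ∃ g ∈ EG n G, y = h * g} := by
  set J := Submodule.span ℚ {y : E n | ∃ h ∈ EGplus n H, ∃ g ∈ EG n G, y = h * g} with hJ
  have hne : w₀ ≠ 0 := by
    rintro rfl
    exact h₀ (by rw [hw₀]; simp)
  have hmem : w₀ ∈ EGdeg n H d₀ := by
    rw [hw₀]; exact Submodule.mem_span_singleton_self w₀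
  obtain ⟨hwH, hwd⟩ := hmem
  refine core (fkData n) G H hHG d₀ w₀ hwH hwd hne J ?_ w hw hkill
  intro i j hij g hg
  exact Submodule.subset_span ⟨_, x_mem_plus n H i j hij, g, hg, rfl⟩

end FK
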